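/- Let p be an odd prime, f : ℤ_p → ℤ_p continuous, and λ ∈ ℚ_p with ‖λ‖_p > 1. Then the function s ↦ ζ_{p,E}^f(s,λ), defined on the open subset ℤ_p of ℚ_p, is differentiable at s = 0, the fermionic integral ∫_{ℤ_p} (λ+f(a))·log_p(λ+f(a)) dμ_{−1}(a) exists, and log Γ_{p,E}^f(λ) := ω_v(λ)·(d/ds ζ_{p,E}^f(s,λ))|_{s=0} = −∫_{ℤ_p} (λ+f(a))·log_p(λ+f(a)) dμ_{−1}(a). -/

import Mathlib

open Filter Topology

namespace PZeta

variable (p : ℕ) [Fact p.Prime]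

/-- The `N`-th partial sum defining the fermionic integral
`∫_{ℤ_p} g dμ₋₁ = lim_N Σ_{a=0}^{p^N-1} (-1)^a g(a)`. -/
noncomputable def fermSum (g : ℤ_[p] → ℚ_[p]) (N : ℕ) : ℚ_[p] :=
  ∑ a ∈ Finset.range (p ^ N), (-1 : ℚ_[p]) ^ a * g (a : ℤ_[p])

/-- The `N`-th partial sum defining the Volkenborn integral
`∫_{ℤ_p} g da = lim_N p^{-N} Σ_{a=0}^{p^N-1} g(a)`. -/
noncomputable def volkSum (g : ℤ_[p] → ℚ_[p]) (N : ℕ) : ℚ_[p] :=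
  ((p : ℚ_[p]) ^ N)⁻¹ * ∑ a ∈ Finset.range (p ^ N), g (a : ℤ_[p])

/-- The unit part `x·p^{-v_p(x)}` of a nonzero `p`-adic number. -/
noncomputable def unitPart (x : ℚ_[p]) : ℚ_[p] := x * (p : ℚ_[p]) ^ (-x.valuation)

/-- The Teichmüller representative of a `p`-adic unit, `lim_n x^{p^n}`. -/
noncomputable def teich (x : ℚ_[p]) : ℚ_[p] :=
  limUnder atTop fun n : ℕ => x ^ p ^ n

/-- The projection `⟨x⟩ ∈ 1 + pℤ_p`, via `x = p^{v_p(x)}·ζ·⟨x⟩`. -/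
noncomputable def angle (x : ℚ_[p]) : ℚ_[p] := unitPart p x / teich p (unitPart p x)

/-- `ω_v(x) := x / ⟨x⟩ = p^{v_p(x)}·ζ`. -/
noncomputable def omegaV (x : ℚ_[p]) : ℚ_[p] := x / angle p x

/-- The generalized binomial coefficient `C(t,n) = t(t-1)⋯(t-n+1)/n!`. -/
noncomputable def gbinom (t : ℚ_[p]) (n : ℕ) : ℚ_[p] :=
  (∏ i ∈ Finset.range n, (t - (i : ℚ_[p]))) / (n.factorial : ℚ_[p])

/-- The power `y^t` defined by the binomial series `Σ_n C(t,n)(y-1)^n`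
(used for `y ∈ 1 + pℤ_p` and `t ∈ ℤ_p`). -/
noncomputable def bpow (y t : ℚ_[p]) : ℚ_[p] := ∑' n : ℕ, gbinom p t n * (y - 1) ^ n

/-- The Iwasawa `p`-adic logarithm: `log_p x = Σ_{n≥1} (-1)^{n+1}(⟨x⟩-1)^n/n`
(one has `log_p p = 0` and `log_p ζ = 0` for roots of unity of order prime to `p`). -/
noncomputable def padicLog (x : ℚ_[p]) : ℚ_[p] :=
  ∑' n : ℕ, (-1 : ℚ_[p]) ^ n * (angle p x - 1) ^ (n + 1) / ((n : ℚ_[p]) + 1)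

/-- The power `y^t` defined by the exponential series `Σ_n (t·log_p y)^n/n!`
(used for `y ∈ 1 + pℤ_p` and `‖t‖ < p^{(p-2)/(p-1)}`). -/
noncomputable def epow (y t : ℚ_[p]) : ℚ_[p] :=
  ∑' n : ℕ, (t * padicLog p y) ^ n / (n.factorial : ℚ_[p])

/-- `f : ℤ_p → ℤ_p` is everywhere analytic with integral coefficients:
`f(x) = Σ_k c_k x^k` with `‖c_k‖ ≤ 1`, `c_k → 0`. -/
def EverywhereAnalytic (f : ℤ_[p] → ℤ_[p]) : Prop :=
  ∃ c : ℕ → ℚ_[p], (∀ k, ‖c k‖ ≤ 1) ∧ Tendsto c atTop (𝓝 0) ∧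
    ∀ x : ℤ_[p], (f x : ℚ_[p]) = ∑' k : ℕ, c k * (x : ℚ_[p]) ^ k

/-- The `p`-adic Hurwitz-type Euler zeta function w.r.t. `f`:
`ζ_{p,E}^f(s,λ) = ∫_{ℤ_p} ⟨λ+f(a)⟩^{1-s} dμ₋₁(a)`. -/
noncomputable def zetaE (f : ℤ_[p] → ℤ_[p]) (s : ℤ_[p]) (lam : ℚ_[p]) : ℚ_[p] :=
  limUnder atTop
    (fermSum p fun a => bpow p (angle p (lam + (f a : ℚ_[p]))) (1 - (s : ℚ_[p])))

/-- The `p`-adic Hurwitz zeta function w.r.t. `f`: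
`ζ_p^f(s,λ) = (s-1)⁻¹ ∫_{ℤ_p} ⟨λ+f(a)⟩^{1-s} da`. -/
noncomputable def zetaH (f : ℤ_[p] → ℤ_[p]) (s : ℤ_[p]) (lam : ℚ_[p]) : ℚ_[p] :=
  ((s : ℚ_[p]) - 1)⁻¹ *
    limUnder atTop
      (volkSum p fun a => bpow p (angle p (lam + (f a : ℚ_[p]))) (1 - (s : ℚ_[p])))

end PZeta

open PZeta

namespace PZeta

variable {p : ℕ} [Fact p.Prime]

section FermionicIntegral

theorem fermSum_sub (g h : ℤ_[p] → ℚ_[p]) (N : ℕ) :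
    fermSum p (fun a => g a - h a) N = fermSum p g N - fermSum p h N := by
  simp only [fermSum, mul_sub, Finset.sum_sub_distrib]

theorem fermSum_const_mul (c : ℚ_[p]) (g : ℤ_[p] → ℚ_[p]) (N : ℕ) :
    fermSum p (fun a => c * g a) N = c * fermSum p g N := by
  simp only [fermSum, Finset.mul_sum, mul_left_comm]

theorem norm_fermSum_le {g : ℤ_[p] → ℚ_[p]} {C : ℝ} (hC : 0 ≤ C) (hg : ∀ a, ‖g a‖ ≤ C) (N : ℕ) :
    ‖fermSum p g N‖ ≤ C :=
  IsUltrametricDist.norm_sum_le_of_forall_le_of_nonneg hC fun a _ => by simpa using hg a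

/-- If `g` varies by at most `ε` along each residue class modulo the odd number `q`, its alternating
sum over `q * m` terms is, up to `ε`, the product of its alternating sum over `q` terms with the
alternating sum of `m` ones. -/
theorem norm_alternating_sum_sub_le {q : ℕ} (hq : Odd q) {g : ℕ → ℚ_[p]} {ε : ℝ} (hε : 0 ≤ ε)
    (hg : ∀ a j, ‖g (q * j + a) - g a‖ ≤ ε) (m : ℕ) :
    ‖∑ a ∈ Finset.range (q * m), (-1 : ℚ_[p]) ^ a * g a -
      (∑ j ∈ Finset.range m, (-1 : ℚ_[p]) ^ j) *
        ∑ a ∈ Finset.range q, (-1 : ℚ_[p]) ^ a * g a‖ ≤ ε := by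
  induction m with
  | zero => simpa using hε
  | succ m ih =>
    have key : ∑ a ∈ Finset.range (q * (m + 1)), (-1 : ℚ_[p]) ^ a * g a -
        (∑ j ∈ Finset.range (m + 1), (-1 : ℚ_[p]) ^ j) *
          ∑ a ∈ Finset.range q, (-1 : ℚ_[p]) ^ a * g a =
        (∑ a ∈ Finset.range (q * m), (-1 : ℚ_[p]) ^ a * g a -
          (∑ j ∈ Finset.range m, (-1 : ℚ_[p]) ^ j) *
            ∑ a ∈ Finset.range q, (-1 : ℚ_[p]) ^ a * g a) +
        ∑ a ∈ Finset.range q, (-1 : ℚ_[p]) ^ m * (-1) ^ a * (g (q * m + a) - g a) := by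
      have h1 : ∀ a, (-1 : ℚ_[p]) ^ (q * m + a) = (-1) ^ m * (-1) ^ a := fun a => by
        rw [pow_add, pow_mul, hq.neg_one_pow]
      rw [mul_add, mul_one, Finset.sum_range_add, Finset.sum_range_succ]
      simp only [h1, mul_sub, Finset.sum_sub_distrib, mul_assoc, ← Finset.mul_sum]
      ring
    rw [key]
    refine (IsUltrametricDist.norm_add_le_max _ _).trans (max_le ih ?_)
    exact IsUltrametricDist.norm_sum_le_of_forall_le_of_nonneg hε fun a _ => by
      simpa using hg a m

theorem tendsto_fermSum_succ_sub (hp : Odd p) {g : ℤ_[p] → ℚ_[p]} (hg : Continuous g) :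
    Tendsto (fun N => fermSum p g (N + 1) - fermSum p g N) atTop (𝓝 0) := by
  have huc := CompactSpace.uniformContinuous_of_continuous hg
  rw [Metric.uniformContinuous_iff] at huc
  rw [Metric.tendsto_atTop]
  intro ε hε
  obtain ⟨δ, hδ, hgδ⟩ := huc (ε / 2) (half_pos hε)
  have hlim : Tendsto (fun N : ℕ => ‖(p : ℤ_[p])‖ ^ N) atTop (𝓝 0) :=
    tendsto_pow_atTop_nhds_zero_of_lt_one (norm_nonneg _) Padic.norm_p_lt_one
  obtain ⟨N₀, hN₀⟩ := eventually_atTop.1 (hlim.eventually_lt_const hδ)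
  refine ⟨N₀, fun N hN => ?_⟩
  have h := norm_alternating_sum_sub_le (p := p) (q := p ^ N) (g := fun a => g (a : ℤ_[p]))
    hp.pow (half_pos hε).le (fun a j => ?_) p
  · rw [dist_zero_right]
    have h1 : ∑ j ∈ Finset.range p, (-1 : ℚ_[p]) ^ j = 1 := by
      rw [neg_one_geom_sum, if_neg (Nat.not_even_iff_odd.2 hp)]
    rw [h1, one_mul, ← pow_succ] at h
    exact h.trans_lt (half_lt_self hε)
  · rw [← dist_eq_norm]
    refine (hgδ ?_).le
    rw [dist_eq_norm]
    push_cast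
    rw [add_sub_cancel_right, norm_mul, norm_pow]
    exact (mul_le_of_le_one_right (by positivity) (PadicInt.norm_le_one _)).trans_lt (hN₀ N hN)

theorem tendsto_fermSum (hp : Odd p) {g : ℤ_[p] → ℚ_[p]} (hg : Continuous g) :
    Tendsto (fermSum p g) atTop (𝓝 (limUnder atTop (fermSum p g))) :=
  (NonarchimedeanAddGroup.cauchySeq_of_tendsto_sub_nhds_zero
    (tendsto_fermSum_succ_sub hp hg)).tendsto_limUnder

end FermionicIntegral

section Teichmuller

theorem tendsto_zero_of_pow_dvd {u : ℕ → ℤ_[p]} (h : ∀ n, (p : ℤ_[p]) ^ (n + 1) ∣ u n) :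
    Tendsto u atTop (𝓝 0) := by
  refine squeeze_zero_norm (a := fun n => ‖(p : ℤ_[p])‖ ^ (n + 1)) (fun n => ?_)
    ((tendsto_add_atTop_iff_nat 1).2
      (tendsto_pow_atTop_nhds_zero_of_lt_one (norm_nonneg _) Padic.norm_p_lt_one))
  obtain ⟨c, hc⟩ := h n
  rw [hc, norm_mul, norm_pow]
  exact mul_le_of_le_one_right (by positivity) (PadicInt.norm_le_one _)

theorem dvd_pow_self_sub (x : ℤ_[p]) : (p : ℤ_[p]) ∣ x ^ p - x := by
  rw [← Ideal.mem_span_singleton, ← PadicInt.maximalIdeal_eq_span_p, ← PadicInt.ker_toZMod,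
    RingHom.mem_ker, map_sub, map_pow, ZMod.pow_card, sub_self]

theorem dvd_pow_pow_self_sub (x : ℤ_[p]) (n : ℕ) : (p : ℤ_[p]) ∣ x ^ p ^ n - x := by
  induction n with
  | zero => simp
  | succ n ih =>
    have h := dvd_add (dvd_pow_self_sub (x ^ p ^ n)) ih
    rwa [sub_add_sub_cancel, ← pow_mul, ← pow_succ] at h

theorem tendsto_teich (x : ℤ_[p]) :
    Tendsto (fun n : ℕ => (x : ℚ_[p]) ^ p ^ n) atTop (𝓝 (teich p x)) := by
  have hc : CauchySeq fun n : ℕ => x ^ p ^ n := by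
    refine NonarchimedeanAddGroup.cauchySeq_of_tendsto_sub_nhds_zero
      (tendsto_zero_of_pow_dvd fun n => ?_)
    rw [pow_succ' p, pow_mul]
    exact dvd_sub_pow_of_dvd_sub (dvd_pow_self_sub x) n
  obtain ⟨y, hy⟩ := cauchySeq_tendsto_of_complete hc
  have hy' : Tendsto (fun n : ℕ => (x : ℚ_[p]) ^ p ^ n) atTop (𝓝 (y : ℚ_[p])) :=
    ((PadicInt.isOpenEmbedding_coe.continuous.tendsto y).comp hy).congr fun n =>
      PadicInt.coe_pow x (p ^ n)
  exact tendsto_nhds_limUnder ⟨_, hy'⟩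

theorem teich_eq_of_norm_sub_lt {x y : ℤ_[p]} (h : ‖x - y‖ < 1) :
    teich p (x : ℚ_[p]) = teich p y := by
  rw [PadicInt.norm_lt_one_iff_dvd] at h
  have h0 := tendsto_zero_of_pow_dvd fun n => dvd_sub_pow_of_dvd_sub h n
  have h1 : Tendsto (fun n : ℕ => (x : ℚ_[p]) ^ p ^ n - (y : ℚ_[p]) ^ p ^ n) atTop (𝓝 0) := by
    have h2 := (PadicInt.isOpenEmbedding_coe.continuous.tendsto (0 : ℤ_[p])).comp h0
    rw [PadicInt.coe_zero] at h2
    exact h2.congr fun n =>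
      (PadicInt.coe_sub _ _).trans (by rw [PadicInt.coe_pow, PadicInt.coe_pow])
  exact sub_eq_zero.1 (tendsto_nhds_unique ((tendsto_teich x).sub (tendsto_teich y)) h1)

theorem norm_sub_teich_le (x : ℤ_[p]) : ‖(x : ℚ_[p]) - teich p x‖ ≤ (p : ℝ)⁻¹ := by
  refine le_of_tendsto ((tendsto_teich x).const_sub (x : ℚ_[p])).norm (Eventually.of_forall ?_)
  intro n
  obtain ⟨c, hc⟩ := dvd_pow_pow_self_sub x n
  rw [norm_sub_rev, ← PadicInt.coe_pow, ← PadicInt.coe_sub, hc, PadicInt.coe_mul, norm_mul]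
  simpa using mul_le_of_le_one_right (inv_nonneg.2 (Nat.cast_nonneg p)) (PadicInt.norm_le_one c)

theorem norm_teich {x : ℤ_[p]} (hx : ‖x‖ = 1) : ‖teich p (x : ℚ_[p])‖ = 1 := by
  have h : ‖(x : ℚ_[p]) - teich p x‖ < ‖(x : ℚ_[p])‖ := by
    rw [← PadicInt.norm_def, hx]
    exact (norm_sub_teich_le x).trans_lt
      (inv_lt_one_of_one_lt₀ (mod_cast (Fact.out : p.Prime).one_lt))
  rw [← Padic.norm_eq_of_norm_sub_lt_left h, ← PadicInt.norm_def, hx]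

theorem norm_unitPart {x : ℚ_[p]} (hx : x ≠ 0) : ‖unitPart p x‖ = 1 := by
  have hp0 : (p : ℝ) ≠ 0 := mod_cast (Fact.out : p.Prime).ne_zero
  rw [unitPart, norm_mul, Padic.norm_p_zpow, neg_neg, Padic.norm_eq_zpow_neg_valuation hx,
    ← zpow_add₀ hp0, neg_add_cancel, zpow_zero]

theorem norm_teich_unitPart {x : ℚ_[p]} (hx : x ≠ 0) : ‖teich p (unitPart p x)‖ = 1 :=
  norm_teich (x := ⟨unitPart p x, (norm_unitPart hx).le⟩) (norm_unitPart hx)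

theorem norm_angle_sub_one_le {x : ℚ_[p]} (hx : x ≠ 0) : ‖angle p x - 1‖ ≤ (p : ℝ)⁻¹ := by
  have ht := norm_teich_unitPart hx
  have ht0 : teich p (unitPart p x) ≠ 0 := norm_ne_zero_iff.1 (by rw [ht]; exact one_ne_zero)
  have h := norm_sub_teich_le (p := p) ⟨unitPart p x, (norm_unitPart hx).le⟩
  rw [angle, div_sub_one ht0, norm_div, ht, div_one]
  exact h

theorem angle_ne_zero {x : ℚ_[p]} (hx : x ≠ 0) : angle p x ≠ 0 :=
  div_ne_zero (norm_ne_zero_iff.1 (by rw [norm_unitPart hx]; exact one_ne_zero))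
    (norm_ne_zero_iff.1 (by rw [norm_teich_unitPart hx]; exact one_ne_zero))

theorem add_ne_zero_of_norm_lt {x z : ℚ_[p]} (h : ‖z‖ < ‖x‖) : x + z ≠ 0 := by
  rw [← norm_pos_iff, Padic.add_eq_max_of_ne h.ne', max_eq_left h.le]
  exact (norm_nonneg z).trans_lt h

/-- `x + z` and `x` have the same `ω_v` when `z` is smaller than `x`. -/
theorem angle_add_of_norm_lt {x z : ℚ_[p]} (h : ‖z‖ < ‖x‖) :
    angle p (x + z) = (x + z) * (omegaV p x)⁻¹ := by
  have hx : x ≠ 0 := norm_pos_iff.1 ((norm_nonneg z).trans_lt h)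
  have hxz : x + z ≠ 0 := add_ne_zero_of_norm_lt h
  have hnorm : ‖x + z‖ = ‖x‖ := by rw [Padic.add_eq_max_of_ne h.ne', max_eq_left h.le]
  have hp1 : (1 : ℝ) < p := mod_cast (Fact.out : p.Prime).one_lt
  have hval : (x + z).valuation = x.valuation := by
    rw [Padic.norm_eq_zpow_neg_valuation hx, Padic.norm_eq_zpow_neg_valuation hxz] at hnorm
    exact neg_injective (zpow_right_injective₀ (by linarith) hp1.ne' hnorm)
  have hteich : teich p (unitPart p (x + z)) = teich p (unitPart p x) := by
    refine teich_eq_of_norm_sub_lt (x := ⟨unitPart p (x + z), (norm_unitPart hxz).le⟩)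
      (y := ⟨unitPart p x, (norm_unitPart hx).le⟩) ?_
    change ‖unitPart p (x + z) - unitPart p x‖ < 1
    have hu := norm_unitPart hx
    simp only [unitPart, hval, norm_mul] at hu ⊢
    rw [← sub_mul, add_sub_cancel_left, norm_mul, ← hu]
    have : 0 < ‖(p : ℚ_[p]) ^ (-x.valuation)‖ :=
      norm_pos_iff.2 (zpow_ne_zero _ (mod_cast (Fact.out : p.Prime).ne_zero))
    exact mul_lt_mul_of_pos_right h this
  rw [omegaV, angle, hteich, unitPart, hval, angle, unitPart, inv_div]
  field_simp

end Teichmuller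

section Series

/-- The series `log (1 + u) = Σ_{n ≥ 0} (-1)^n u^(n+1) / (n+1)`. -/
noncomputable def logOneAdd (u : ℚ_[p]) : ℚ_[p] :=
  ∑' n : ℕ, (-1 : ℚ_[p]) ^ n * u ^ (n + 1) / ((n : ℚ_[p]) + 1)

theorem two_mul_padicValNat_factorial_le (hp : Odd p) (n : ℕ) :
    2 * padicValNat p n.factorial ≤ n := by
  have h := sub_one_mul_padicValNat_factorial (p := p) n
  have h2 : 2 ≤ p - 1 := by
    obtain ⟨k, hk⟩ := hp
    have := (Fact.out : p.Prime).two_le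
    omega
  calc 2 * padicValNat p n.factorial ≤ (p - 1) * padicValNat p n.factorial :=
        Nat.mul_le_mul_right _ h2
    _ ≤ n := h ▸ Nat.sub_le _ _

theorem sqrt_inv_lt_one : √((p : ℝ)⁻¹) < 1 := by
  rw [Real.sqrt_lt' one_pos, one_pow]
  exact inv_lt_one_of_one_lt₀ (mod_cast (Fact.out : p.Prime).one_lt)

theorem norm_pow_div_factorial_le (hp : Odd p) {u : ℚ_[p]} (hu : ‖u‖ ≤ (p : ℝ)⁻¹) (n : ℕ) :
    ‖u ^ n / (n.factorial : ℚ_[p])‖ ≤ √((p : ℝ)⁻¹) ^ n := by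
  have hp1 : (1 : ℝ) < p := mod_cast (Fact.out : p.Prime).one_lt
  have hp0 : (0 : ℝ) < p := by linarith
  refine le_of_sq_le_sq ?_ (by positivity)
  have hfac : ‖(n.factorial : ℚ_[p])‖ = ((p : ℝ) ^ padicValNat p n.factorial)⁻¹ := by
    rw [Padic.norm_eq_zpow_neg_valuation (mod_cast n.factorial_ne_zero), Padic.valuation_natCast,
      zpow_neg, zpow_natCast]
  rw [norm_div, norm_pow, hfac, div_inv_eq_mul, mul_pow, ← pow_mul, ← pow_mul, ← pow_mul,
    mul_comm n 2, pow_mul √_, Real.sq_sqrt (by positivity), mul_comm (padicValNat _ _)]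
  calc ‖u‖ ^ (2 * n) * (p : ℝ) ^ (2 * padicValNat p n.factorial)
      ≤ (p : ℝ)⁻¹ ^ (2 * n) * (p : ℝ) ^ n := by
        gcongr
        · exact hp1.le
        · exact two_mul_padicValNat_factorial_le hp n
    _ = (p : ℝ)⁻¹ ^ n := by
        rw [two_mul, pow_add, mul_assoc, ← mul_pow, inv_mul_cancel₀ hp0.ne', one_pow, mul_one]

theorem norm_mul_pow_div_factorial_le (hp : Odd p) {u : ℚ_[p]} (hu : ‖u‖ ≤ (p : ℝ)⁻¹)
    {c : ℚ_[p]} (hc : ‖c‖ ≤ 1) (n : ℕ) :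
    ‖c * (u ^ n / (n.factorial : ℚ_[p]))‖ ≤ √((p : ℝ)⁻¹) ^ n := by
  rw [norm_mul]
  exact (mul_le_of_le_one_left (norm_nonneg _) hc).trans (norm_pow_div_factorial_le hp hu n)

theorem norm_one_sub_le {s : ℚ_[p]} (hs : ‖s‖ ≤ 1) : ‖1 - s‖ ≤ 1 := by
  rw [sub_eq_add_neg]
  refine (IsUltrametricDist.norm_add_le_max _ _).trans (max_le norm_one.le ?_)
  rwa [norm_neg]

theorem norm_gbinom_mul_pow_le (hp : Odd p) {t u : ℚ_[p]} (ht : ‖t‖ ≤ 1) (hu : ‖u‖ ≤ (p : ℝ)⁻¹)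
    (n : ℕ) : ‖gbinom p t n * u ^ n‖ ≤ √((p : ℝ)⁻¹) ^ n := by
  rw [gbinom, div_mul_eq_mul_div, mul_div_assoc]
  refine norm_mul_pow_div_factorial_le hp hu ?_ n
  rw [norm_prod]
  refine Finset.prod_le_one (fun _ _ => norm_nonneg _) fun i _ => ?_
  rw [sub_eq_add_neg]
  refine (IsUltrametricDist.norm_add_le_max _ _).trans (max_le ht ?_)
  rw [norm_neg]
  exact PadicInt.norm_le_one (i : ℤ_[p])

theorem norm_logOneAdd_term_le (hp : Odd p) {u : ℚ_[p]} (hu : ‖u‖ ≤ (p : ℝ)⁻¹) (n : ℕ) :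
    ‖(-1 : ℚ_[p]) ^ n * u ^ (n + 1) / ((n : ℚ_[p]) + 1)‖ ≤ √((p : ℝ)⁻¹) ^ (n + 1) := by
  have hn : (n : ℚ_[p]) + 1 ≠ 0 := Nat.cast_add_one_ne_zero n
  have hf : (n.factorial : ℚ_[p]) ≠ 0 := mod_cast n.factorial_ne_zero
  have h : (-1 : ℚ_[p]) ^ n * u ^ (n + 1) / ((n : ℚ_[p]) + 1) =
      (-1 : ℚ_[p]) ^ n * n.factorial * (u ^ (n + 1) / ((n + 1).factorial : ℚ_[p])) := by
    rw [Nat.factorial_succ]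
    push_cast
    field_simp
  rw [h]
  refine norm_mul_pow_div_factorial_le hp hu ?_ (n + 1)
  rw [norm_mul, norm_pow, norm_neg, norm_one, one_pow, one_mul]
  exact PadicInt.norm_le_one (n.factorial : ℤ_[p])

theorem summable_sqrt_inv_pow : Summable fun n : ℕ => √((p : ℝ)⁻¹) ^ n :=
  summable_geometric_of_lt_one (Real.sqrt_nonneg _) sqrt_inv_lt_one

theorem summable_sqrt_inv_pow_succ : Summable fun n : ℕ => √((p : ℝ)⁻¹) ^ (n + 1) :=
  (summable_nat_add_iff 1).2 summable_sqrt_inv_pow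

theorem continuous_bpow_comp (hp : Odd p) {X : Type*} [TopologicalSpace X] {Y : X → ℚ_[p]}
    (hY : Continuous Y) (hY1 : ∀ x, ‖Y x - 1‖ ≤ (p : ℝ)⁻¹) {t : ℚ_[p]} (ht : ‖t‖ ≤ 1) :
    Continuous fun x => bpow p (Y x) t :=
  continuous_tsum (fun n => by fun_prop) summable_sqrt_inv_pow
    fun n x => norm_gbinom_mul_pow_le hp ht (hY1 x) n

theorem continuous_logOneAdd_comp (hp : Odd p) {X : Type*} [TopologicalSpace X] {U : X → ℚ_[p]}
    (hU : Continuous U) (hU1 : ∀ x, ‖U x‖ ≤ (p : ℝ)⁻¹) :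
    Continuous fun x => logOneAdd (U x) :=
  continuous_tsum (fun n => by fun_prop) summable_sqrt_inv_pow_succ
    fun n x => norm_logOneAdd_term_le hp (hU1 x) n

/-- `(1 + u) log (1 + u) = u + Σ_{n ≥ 0} (-1)^n u^(n+2) / ((n+1)(n+2))`. -/
theorem hasSum_one_add_mul_logOneAdd (hp : Odd p) {u : ℚ_[p]} (hu : ‖u‖ ≤ (p : ℝ)⁻¹) :
    HasSum (fun n : ℕ => (-1 : ℚ_[p]) ^ n * u ^ (n + 2) / (((n : ℚ_[p]) + 1) * (n + 2)))
      ((1 + u) * logOneAdd u - u) := by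
  have hs : HasSum (fun n : ℕ => (-1 : ℚ_[p]) ^ n * u ^ (n + 1) / ((n : ℚ_[p]) + 1))
      (logOneAdd u) :=
    (summable_sqrt_inv_pow_succ.of_norm_bounded (norm_logOneAdd_term_le hp hu)).hasSum
  have h := ((hasSum_nat_add_iff' 1).2 hs).add (hs.mul_left u)
  have hval : (1 + u) * logOneAdd u - u = logOneAdd u -
      ∑ i ∈ Finset.range 1, (-1 : ℚ_[p]) ^ i * u ^ (i + 1) / ((i : ℚ_[p]) + 1) +
        u * logOneAdd u := by
    simp
    ring
  have hterm : ∀ n : ℕ, (-1 : ℚ_[p]) ^ n * u ^ (n + 2) / (((n : ℚ_[p]) + 1) * (n + 2)) =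
      (-1 : ℚ_[p]) ^ (n + 1) * u ^ (n + 1 + 1) / (((n + 1 : ℕ) : ℚ_[p]) + 1) +
        u * ((-1 : ℚ_[p]) ^ n * u ^ (n + 1) / ((n : ℚ_[p]) + 1)) := fun n => by
    have h1 : (n : ℚ_[p]) + 1 ≠ 0 := Nat.cast_add_one_ne_zero n
    have h2 : (n : ℚ_[p]) + 2 ≠ 0 := by exact_mod_cast (Nat.succ_ne_zero (n + 1))
    have h3 : ((n + 1 : ℕ) : ℚ_[p]) + 1 = n + 2 := by push_cast; ring
    rw [h3]
    field_simp
    ring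
  rw [hval, funext hterm]
  exact h

/-- Second order expansion in `s` of the falling factorial `(1-s)(-s)(-1-s)⋯(-n-s)`. -/
theorem exists_prod_one_sub_sub_eq {s : ℚ_[p]} (hs : ‖s‖ ≤ 1) (n : ℕ) :
    ∃ k : ℚ_[p], ‖k‖ ≤ 1 ∧ ∏ i ∈ Finset.range (n + 2), (1 - s - (i : ℚ_[p])) =
      -s * (-1) ^ n * n.factorial + s ^ 2 * k := by
  induction n with
  | zero =>
    refine ⟨1, by simp, ?_⟩
    simp [Finset.prod_range_succ]
    ring
  | succ n ih =>
    obtain ⟨k, hk, h⟩ := ih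
    refine ⟨(-1) ^ n * n.factorial + k * (-(n + 1) - s), ?_, ?_⟩
    · obtain ⟨k, rfl⟩ : ∃ k' : ℤ_[p], (k' : ℚ_[p]) = k := ⟨⟨k, hk⟩, rfl⟩
      obtain ⟨s, rfl⟩ : ∃ s' : ℤ_[p], (s' : ℚ_[p]) = s := ⟨⟨s, hs⟩, rfl⟩
      have := PadicInt.norm_le_one ((-1 : ℤ_[p]) ^ n * (n.factorial : ℤ_[p]) +
        k * (-((n : ℤ_[p]) + 1) - s))
      rw [PadicInt.norm_def] at this
      push_cast at this
      exact this
    · rw [Finset.prod_range_succ, h, Nat.factorial_succ]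
      push_cast
      ring

/-- Second order expansion `y^(1-s) = y - s·y·log y + O(s²)`, with an explicit uniform constant. -/
theorem norm_bpow_one_sub_sub_le (hp : Odd p) {y s : ℚ_[p]} (hy : ‖y - 1‖ ≤ (p : ℝ)⁻¹)
    (hs : ‖s‖ ≤ 1) :
    ‖bpow p y (1 - s) - (y - s * (y * logOneAdd (y - 1)))‖ ≤ ‖s‖ ^ 2 := by
  obtain ⟨u, rfl⟩ : ∃ u, y = 1 + u := ⟨y - 1, by ring⟩
  rw [add_sub_cancel_left] at hy ⊢
  have h1s : ‖1 - s‖ ≤ 1 := norm_one_sub_le hs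
  have hsum : HasSum (fun n => gbinom p (1 - s) n * u ^ n) (bpow p (1 + u) (1 - s)) := by
    rw [bpow, add_sub_cancel_left]
    exact (summable_sqrt_inv_pow.of_norm_bounded (norm_gbinom_mul_pow_le hp h1s hy)).hasSum
  have h := ((hasSum_nat_add_iff' 2).2 hsum).add
    ((hasSum_one_add_mul_logOneAdd hp hy).mul_left s)
  have hval : bpow p (1 + u) (1 - s) - (1 + u - s * ((1 + u) * logOneAdd u)) =
      bpow p (1 + u) (1 - s) - ∑ i ∈ Finset.range 2, gbinom p (1 - s) i * u ^ i +
        s * ((1 + u) * logOneAdd u - u) := by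
    simp [Finset.sum_range_succ, gbinom]
    ring
  rw [hval, ← h.tsum_eq]
  refine IsUltrametricDist.norm_tsum_le_of_forall_le_of_nonneg (by positivity) fun n => ?_
  obtain ⟨k, hk, hprod⟩ := exists_prod_one_sub_sub_eq hs n
  have hterm : gbinom p (1 - s) (n + 2) * u ^ (n + 2) +
      s * ((-1 : ℚ_[p]) ^ n * u ^ (n + 2) / (((n : ℚ_[p]) + 1) * (n + 2))) =
      s ^ 2 * (k * (u ^ (n + 2) / ((n + 2).factorial : ℚ_[p]))) := by
    have h1 : (n : ℚ_[p]) + 1 ≠ 0 := Nat.cast_add_one_ne_zero n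
    have h2 : (n : ℚ_[p]) + 2 ≠ 0 := by exact_mod_cast (Nat.succ_ne_zero (n + 1))
    have hf : (n.factorial : ℚ_[p]) ≠ 0 := mod_cast n.factorial_ne_zero
    have h3 : ((n + 2).factorial : ℚ_[p]) = (n + 2) * ((n + 1) * n.factorial) := by
      rw [Nat.factorial_succ, Nat.factorial_succ]
      push_cast
      ring
    rw [gbinom, hprod, h3]
    field_simp
    ring
  rw [hterm, norm_mul, norm_pow]
  refine mul_le_of_le_one_right (by positivity) ?_
  exact (norm_mul_pow_div_factorial_le hp hy hk _).trans
    (pow_le_one₀ (Real.sqrt_nonneg _) sqrt_inv_lt_one.le)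

end Series

/-- Differentiation under the fermionic integral sign. -/
theorem hasDerivAt_limUnder_fermSum_bpow (hp : Odd p) {Y : ℤ_[p] → ℚ_[p]} (hY : Continuous Y)
    (hY1 : ∀ a, ‖Y a - 1‖ ≤ (p : ℝ)⁻¹) :
    HasDerivAt (fun s : ℚ_[p] => limUnder atTop (fermSum p fun a => bpow p (Y a) (1 - s)))
      (-limUnder atTop (fermSum p fun a => Y a * logOneAdd (Y a - 1))) 0 := by
  set F := fun s : ℚ_[p] => limUnder atTop (fermSum p fun a => bpow p (Y a) (1 - s)) with hF
  set I := limUnder atTop (fermSum p Y)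
  set J := limUnder atTop (fermSum p fun a => Y a * logOneAdd (Y a - 1))
  have hlog : Continuous fun a => Y a * logOneAdd (Y a - 1) :=
    hY.mul (continuous_logOneAdd_comp hp (hY.sub continuous_const) hY1)
  have hbound : ∀ s : ℚ_[p], ‖s‖ ≤ 1 → ‖F s - (I - s * J)‖ ≤ ‖s‖ ^ 2 := by
    intro s hs
    have h1s : ‖1 - s‖ ≤ 1 := norm_one_sub_le hs
    have hlim := (tendsto_fermSum hp (continuous_bpow_comp hp hY hY1 h1s)).sub
      ((tendsto_fermSum hp hY).sub ((tendsto_fermSum hp hlog).const_mul s))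
    refine le_of_tendsto hlim.norm (Eventually.of_forall fun N => ?_)
    rw [← fermSum_const_mul, ← fermSum_sub, ← fermSum_sub]
    exact norm_fermSum_le (by positivity) (fun a => norm_bpow_one_sub_sub_le hp (hY1 a) hs) N
  have hF0 : F 0 = I := by
    have h := hbound 0 (by simp)
    simpa [sub_eq_zero] using h
  rw [hasDerivAt_iff_isLittleO_nhds_zero]
  refine Asymptotics.IsBigO.trans_isLittleO (g := fun s : ℚ_[p] => s ^ 2) ?_ ?_
  · refine Asymptotics.IsBigO.of_bound 1 ?_
    filter_upwards [Metric.closedBall_mem_nhds (0 : ℚ_[p]) one_pos] with s hs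
    rw [mem_closedBall_zero_iff] at hs
    have h := hbound s hs
    rw [norm_pow, one_mul, zero_add, hF0, smul_eq_mul]
    rw [sub_sub, mul_neg, ← sub_eq_add_neg]
    exact h
  · simpa using Asymptotics.isLittleO_pow_id (𝕜 := ℚ_[p]) one_lt_two

end PZeta

/-- the function `s ↦ ζ_{p,E}^f(s,λ)` is differentiable at `s = 0`, the
fermionic integral `∫_{ℤ_p} (λ+f(a))·log_p(λ+f(a)) dμ₋₁(a)` exists, and
`log Γ_{p,E}^f(λ) = ω_v(λ)·(d/ds ζ_{p,E}^f(s,λ))|_{s=0} = -∫_{ℤ_p} (λ+f(a)) log_p(λ+f(a)) dμ₋₁(a)`. -/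
theorem logGammaE_integral_representation (p : ℕ) [Fact p.Prime] (hp : Odd p)
    (f : ℤ_[p] → ℤ_[p]) (hf : Continuous f) (lam : ℚ_[p]) (hlam : 1 < ‖lam‖) :
    ∃ D L : ℚ_[p],
      HasDerivAt (fun s : ℚ_[p] =>
          limUnder Filter.atTop
            (fermSum p fun a => bpow p (angle p (lam + (f a : ℚ_[p]))) (1 - s))) D 0 ∧
      Filter.Tendsto
        (fermSum p fun a =>
          (lam + (f a : ℚ_[p])) * padicLog p (lam + (f a : ℚ_[p])))
        Filter.atTop (nhds L) ∧
      omegaV p lam * D = -L := by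
  have hnorm : ∀ a, ‖(f a : ℚ_[p])‖ < ‖lam‖ := fun a => (PadicInt.norm_le_one (f a)).trans_lt hlam
  have hlam0 : lam ≠ 0 := norm_pos_iff.1 (one_pos.trans hlam)
  have hω : omegaV p lam ≠ 0 := div_ne_zero hlam0 (angle_ne_zero hlam0)
  have hY1 : ∀ a, ‖angle p (lam + (f a : ℚ_[p])) - 1‖ ≤ (p : ℝ)⁻¹ := fun a =>
    norm_angle_sub_one_le (add_ne_zero_of_norm_lt (hnorm a))
  have hY : Continuous fun a => angle p (lam + (f a : ℚ_[p])) := by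
    simp only [angle_add_of_norm_lt (hnorm _)]
    exact (continuous_const.add (PadicInt.isOpenEmbedding_coe.continuous.comp hf)).mul continuous_const
  have hlog : Continuous fun a => angle p (lam + (f a : ℚ_[p])) *
      logOneAdd (angle p (lam + (f a : ℚ_[p])) - 1) :=
    hY.mul (continuous_logOneAdd_comp hp (hY.sub continuous_const) hY1)
  refine ⟨_, _, hasDerivAt_limUnder_fermSum_bpow hp hY hY1, ?_, mul_neg _ _⟩
  have h := (tendsto_fermSum hp hlog).const_mul (omegaV p lam)
  simp only [← fermSum_const_mul] at h
  convert h using 3 with a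
  have hx : lam + (f a : ℚ_[p]) = omegaV p lam * angle p (lam + (f a : ℚ_[p])) := by
    rw [angle_add_of_norm_lt (hnorm a), mul_comm, inv_mul_cancel_right₀ hω]
  rw [← mul_assoc, ← hx]
  rfl
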